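/- For every integer d ≥ 3 and every integer v with 3[d-1]₄ ≤ v ≤ [d]₄, there exists a legal truncation of PG_d(4) leaving exactly v points; consequently, for every such v there exists a PBD(v,{3,4,5}) in which every set of three points is contained in a flat of size at most 21. -/

import Mathlib

/-- `IsPBD V K Blocks` : the blocks form a pairwise balanced design on point set `V`
with block sizes in `K`: every block is a subset of `V` of size in `K`, and every
pair of distinct points of `V` lies in exactly one block. -/
def IsPBD {X : Type*} (V : Finset X) (K : Set ℕ) (Blocks : Finset (Finset X)) : Prop :=
  (∀ B ∈ Blocks, B ⊆ V ∧ B.card ∈ K) ∧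
    ∀ x ∈ V, ∀ y ∈ V, x ≠ y → ∃! B, B ∈ Blocks ∧ x ∈ B ∧ y ∈ B

/-- `IsFlat V Blocks Y` : `Y` is a flat of the design `(V, Blocks)`: `Y ⊆ V` and every
pair of distinct points of `Y` lies in a block entirely contained in `Y`. -/
def IsFlat {X : Type*} (V : Finset X) (Blocks : Finset (Finset X)) (Y : Finset X) : Prop :=
  Y ⊆ V ∧ ∀ x ∈ Y, ∀ y ∈ Y, x ≠ y → ∃ B ∈ Blocks, x ∈ B ∧ y ∈ B ∧ B ⊆ Y

/-- The field with four elements. -/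
abbrev F4 : Type := GaloisField 2 2

/-- The points of the projective space `PG_d(4)` : one-dimensional subspaces of `F4^(d+1)`. -/
abbrev PGPoint (d : ℕ) := Projectivization F4 (Fin (d + 1) → F4)

/-- The set of projective points lying in a given linear subspace `W` of `F4^(d+1)`. -/
def pointsIn {d : ℕ} (W : Submodule F4 (Fin (d + 1) → F4)) : Set (PGPoint d) :=
  {p | p.submodule ≤ W}

/-- A line of `PG_d(4)` : the set of points contained in some 2-dimensional linear subspace. -/
def IsLine {d : ℕ} (L : Set (PGPoint d)) : Prop :=
  ∃ W : Submodule F4 (Fin (d + 1) → F4), Module.finrank F4 W = 2 ∧ L = pointsIn W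

/-- `LegalTrunc D` : removing the point set `D` from `PG_d(4)` is a legal truncation,
i.e. no line has exactly two points outside `D`. -/
def LegalTrunc {d : ℕ} (D : Set (PGPoint d)) : Prop :=
  ∀ L : Set (PGPoint d), IsLine L → (L \ D).ncard ≠ 2

/-- `bracket4 e = [e]₄ = 1 + 4 + 4² + ⋯ + 4^e`. -/
def bracket4 (e : ℕ) : ℕ := ∑ i ∈ Finset.range (e + 1), 4 ^ i

lemma F4.card : Nat.card F4 = 4 := by
  simpa using GaloisField.card 2 2 (by norm_num)

noncomputable instance : Fintype F4 := Fintype.ofFinite _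

lemma F4.pow_four (x : F4) : x ^ 4 = x := by
  simpa [← Nat.card_eq_fintype_card, F4.card] using FiniteField.pow_card x

lemma F4.two_eq_zero : (2 : F4) = 0 := by
  exact_mod_cast CharP.cast_eq_zero F4 2

lemma F4.exists_omega : ∃ w : F4, w ^ 2 = w + 1 := by
  classical
  have h : ({0, 1} : Finset F4).card < Fintype.card F4 := by
    rw [← Nat.card_eq_fintype_card, F4.card]
    exact Finset.card_le_two.trans_lt (by norm_num)
  obtain ⟨w, -, hw⟩ := Finset.exists_mem_notMem_of_card_lt_card (t := Finset.univ) h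
  simp only [Finset.mem_insert, Finset.mem_singleton, not_or] at hw
  refine ⟨w, ?_⟩
  have h4 := F4.pow_four w
  have h2 := F4.two_eq_zero
  have : w * (w - 1) * (w ^ 2 - (w + 1)) = 0 := by
    linear_combination h4 + (w - w ^ 3) * h2
  have := (mul_eq_zero.1 this).resolve_left (mul_ne_zero hw.1 (sub_ne_zero.2 hw.2))
  exact sub_eq_zero.1 this

lemma F4.exists_notMem_pair (a b u w : F4) (hb : b ≠ 0) :
    ∃ t : F4, t ≠ 0 ∧ a + t * b ≠ u ∧ a + t * b ≠ w := by
  classical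
  by_contra! h
  have hinj : Function.Injective fun t : F4 ↦ a + t * b := fun s t hst ↦ by simpa [hb] using hst
  have hsub : (Finset.univ.erase (0 : F4)).image (fun t ↦ a + t * b) ⊆ {u, w} := by
    intro x hx
    obtain ⟨t, ht, rfl⟩ := Finset.mem_image.1 hx
    by_cases hu : a + t * b = u
    · simp [hu]
    · simp [h t (Finset.ne_of_mem_erase ht) hu]
  have := (Finset.card_le_card hsub).trans Finset.card_le_two
  rw [Finset.card_image_of_injective _ hinj, Finset.card_erase_of_mem (Finset.mem_univ _),
    Finset.card_univ, ← Nat.card_eq_fintype_card, F4.card] at this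
  omega

lemma F4.eq_cases {w : F4} (hw : w ^ 2 = w + 1) (x : F4) : x = 0 ∨ x = 1 ∨ x = w ∨ x = w + 1 := by
  have h4 := F4.pow_four x
  have h2 := F4.two_eq_zero
  have : x * ((x - 1) * ((x - w) * (x - (w + 1)))) = 0 := by
    linear_combination h4 + (x^2-x) * hw + (- x ^ 3 +x^2 - x*w + x^2*w-w * x ^ 3 +w * x^2) * h2
  simpa [sub_eq_zero] using this

/-- Three of the four points of an affine line cannot all satisfy `x² + xy + wy² ∈ {0, 1}`. -/
lemma F4.hyperoval {w a c b e : F4} (hw : w ^ 2 = w + 1)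
    (h : ∀ t : F4, t ≠ 0 →
      IsIdempotentElem ((a + t * b) ^ 2 + (a + t * b) * (c + t * e) + w * (c + t * e) ^ 2)) :
    b = 0 ∧ e = 0 := by
  have h2 := F4.two_eq_zero
  have hw0 : w ≠ 0 := by rintro rfl; simp at hw
  have hw1 : w + 1 ≠ 0 := by rw [← hw]; exact pow_ne_zero 2 hw0
  have e1 := h 1 one_ne_zero
  have e2 := h w hw0
  have e3 := h (w + 1) hw1
  unfold IsIdempotentElem at e1 e2 e3
  have ha := F4.pow_four a
  have hc := F4.pow_four c
  rcases F4.eq_cases hw b with hb | hb | hb | hb <;> rcases F4.eq_cases hw e with he | he | he | he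
    <;> subst hb he <;> grind

/-- `S` meets no affine line over `F4` in exactly three of its four points. -/
def AffineLegal {V : Type*} [AddCommGroup V] [Module F4 V] (S : Set V) : Prop :=
  ∀ a b : V, (∀ t : F4, t ≠ 0 → a + t • b ∈ S) → a ∈ S

/-- There are a `k`-set `S` and three further points, such that adding any subset of them to `S`
gives a set meeting no affine line in exactly three points. -/
def HasFreeTriple (V : Type*) [AddCommGroup V] [Module F4 V] (k : ℕ) : Prop :=
  ∃ S P : Finset V, S.card = k ∧ P.card = 3 ∧ Disjoint S P ∧
    ∀ T : Set V, T ⊆ P → AffineLegal (S ∪ T : Set V)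

section Affine

variable {V : Type*} [AddCommGroup V] [Module F4 V]

lemma HasFreeTriple.of_linearEquiv {W : Type*} [AddCommGroup W] [Module F4 W] (e : V ≃ₗ[F4] W)
    {k : ℕ} (h : HasFreeTriple V k) : HasFreeTriple W k := by
  obtain ⟨S, P, hS, hP, hd, hT⟩ := h
  refine ⟨S.map e.toEquiv.toEmbedding, P.map e.toEquiv.toEmbedding, by simpa, by simpa,
    (Finset.disjoint_map _).2 hd, fun T hTP a b hab ↦ ?_⟩
  have key : ∀ x : W, x ∈ (↑(S.map e.toEquiv.toEmbedding) ∪ T : Set W) ↔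
      e.symm x ∈ (S ∪ e ⁻¹' T : Set V) := by
    intro x
    simp [← LinearEquiv.eq_symm_apply]
  rw [key]
  refine hT _ (fun v hv ↦ ?_) _ (e.symm b) fun t ht ↦ ?_
  · simpa using hTP hv
  · simpa using (key _).1 (hab t ht)

lemma hasFreeTriple_plane {k : ℕ} (hk : k ≤ 3) : HasFreeTriple (F4 × F4) k := by
  classical
  obtain ⟨w, hw⟩ := F4.exists_omega
  have h2 := F4.two_eq_zero
  have hw0 : w ≠ 0 := by rintro rfl; simp at hw
  have hw1 : w + 1 ≠ 0 := by rw [← hw]; exact pow_ne_zero 2 hw0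
  have hw2 : w ≠ 1 := by rintro rfl; grind
  let p : Fin 6 → F4 × F4 := ![(0, 0), (1, 0), (0, w), (w, w), (1, w + 1), (w, w + 1)]
  have hp : Function.Injective p := by
    intro i j hij
    fin_cases i <;> fin_cases j <;> simp [p] at hij ⊢ <;> grind
  have hQ : ∀ i, IsIdempotentElem ((p i).1 ^ 2 + (p i).1 * (p i).2 + w * (p i).2 ^ 2) := by
    intro i
    unfold IsIdempotentElem
    fin_cases i <;> simp [p] <;> grind
  have hA : ∀ U : Set (F4 × F4), U ⊆ Set.range p → AffineLegal U := by
    rintro U hU ⟨a, c⟩ ⟨b, e⟩ hab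
    obtain ⟨rfl, rfl⟩ := F4.hyperoval (a := a) (c := c) (b := b) (e := e) hw fun t ht ↦ by
      obtain ⟨i, hi⟩ := hU (hab t ht)
      simpa [hi] using hQ i
    simpa using hab 1 one_ne_zero
  refine ⟨(Finset.univ.filter fun i : Fin 6 ↦ (i : ℕ) < k).map ⟨p, hp⟩,
    (Finset.univ.filter fun i : Fin 6 ↦ k ≤ i ∧ (i : ℕ) < k + 3).map ⟨p, hp⟩, ?_, ?_, ?_, ?_⟩
  · rw [Finset.card_map]; interval_cases k <;> rfl
  · rw [Finset.card_map]; interval_cases k <;> rfl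
  · rw [Finset.disjoint_map, Finset.disjoint_filter]
    omega
  · refine fun T hT ↦ hA _ (Set.union_subset ?_ (hT.trans ?_)) <;> simp

lemma HasFreeTriple.cylinder [Finite V] {k : ℕ} (h : HasFreeTriple V k) {j : ℕ} (hj : j ≤ 3) :
    HasFreeTriple (V × F4) (4 * k + j) := by
  classical
  obtain ⟨S, P, hS, hP, hd, hT⟩ := h
  obtain ⟨J, hJP, hJ⟩ := Finset.exists_subset_card_eq (hP ▸ hj : j ≤ P.card)
  have inj : Function.Injective fun q : V ↦ (q, if q ∈ J then (1 : F4) else 0) :=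
    fun q r hqr ↦ (Prod.ext_iff.1 hqr).1
  refine ⟨S ×ˢ Finset.univ ∪ J ×ˢ {0}, P.map ⟨_, inj⟩, ?_, by simpa, ?_, ?_⟩
  · rw [Finset.card_union_of_disjoint, Finset.card_product, Finset.card_product, Finset.card_univ,
      ← Nat.card_eq_fintype_card, F4.card, Finset.card_singleton]
    · omega
    · exact Finset.disjoint_product.2 (.inl (hd.mono_right hJP))
  · rw [Finset.disjoint_left]
    rintro ⟨x, t⟩ hx hx'
    simp only [Finset.mem_map, Function.Embedding.coeFn_mk, Prod.mk.injEq] at hx'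
    obtain ⟨q, hq, rfl, rfl⟩ := hx'
    have := Finset.disjoint_right.1 hd hq
    by_cases hqJ : q ∈ J <;> simp_all
  · intro T hTP
    have hU : ∀ x ∈ (↑(S ×ˢ Finset.univ ∪ J ×ˢ {0} : Finset (V × F4)) ∪ T : Set (V × F4)),
        x.1 ∈ S ∨ x.1 ∈ P ∧ (x.2 = 0 ∨ x.2 = 1) := by
      rintro x (hx | hx)
      · simp only [Finset.coe_union, Finset.coe_product, Set.mem_union, Set.mem_prod] at hx
        rcases hx with hx | hx
        · exact .inl hx.1
        · exact .inr ⟨hJP hx.1, .inl (by simpa using hx.2)⟩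
      · obtain ⟨q, hq, rfl⟩ := Finset.mem_map.1 (hTP hx)
        refine .inr ⟨hq, ?_⟩
        by_cases hqJ : q ∈ J <;> simp [hqJ]
    rintro ⟨a, c⟩ ⟨b, e⟩ hab
    by_cases hbe : (b, e) = (0 : V × F4)
    · simpa [hbe] using hab 1 one_ne_zero
    suffices a ∈ S by simp [this]
    by_cases hb : b = 0
    · subst hb
      obtain ⟨t, ht, h0, h1⟩ := F4.exists_notMem_pair c e 0 1 (by simpa using hbe)
      have := hU _ (hab t ht)
      simpa [h0, h1] using this
    · have hmem := hT (P ∩ {v | ∃ t : F4, t ≠ 0 ∧ v = a + t • b}) Set.inter_subset_left a b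
        fun t ht ↦ (hU _ (hab t ht)).imp id fun h ↦ ⟨h.1, t, ht, rfl⟩
      refine hmem.resolve_right ?_
      rintro ⟨-, t, ht, hat⟩
      exact smul_ne_zero ht hb (by simpa using hat)

lemma HasFreeTriple.two_levels [Finite V] {k : ℕ} (h : HasFreeTriple V k) :
    HasFreeTriple (V × F4) (Nat.card V + k) := by
  classical
  have := Fintype.ofFinite V
  obtain ⟨S, P, hS, hP, hd, hT⟩ := h
  refine ⟨Finset.univ ×ˢ {0} ∪ S ×ˢ {1}, P ×ˢ {1}, ?_, by simpa, ?_, ?_⟩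
  · rw [Finset.card_union_of_disjoint, Finset.card_product, Finset.card_product]
    · simp [hS]
    · exact Finset.disjoint_product.2 (.inr (by simp))
  · refine Finset.disjoint_union_left.2 ⟨?_, ?_⟩ <;> rw [Finset.disjoint_product]
    · exact .inr (by simp)
    · exact .inl hd
  · intro T hTP
    have hU : ∀ x : V × F4,
        x ∈ (↑(Finset.univ ×ˢ {0} ∪ S ×ˢ {1} : Finset (V × F4)) ∪ T : Set (V × F4)) ↔
        x.2 = 0 ∨ x.2 = 1 ∧ x.1 ∈ (S ∪ {v | (v, 1) ∈ T} : Set V) := by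
      rintro ⟨v, t⟩
      have : (v, t) ∈ T → t = 1 := fun hv ↦ by simpa using (Finset.mem_product.1 (hTP hv)).2
      simp only [Finset.coe_union, Finset.coe_product]
      by_cases ht : t = 1
      · subst ht; simp
      · simp [ht, mt this ht]
    rintro ⟨a, c⟩ ⟨b, e⟩ hab
    rw [hU]
    by_cases he : e = 0
    · subst he
      by_cases hc : c = 0
      · exact .inl hc
      have hc1 : c = 1 := by simpa [hc] using ((hU _).1 (hab 1 one_ne_zero)).imp id And.left
      refine .inr ⟨hc1, hT _ (fun v hv ↦ ?_) a b fun t ht ↦ ?_⟩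
      · exact (Finset.mem_product.1 (hTP hv)).1
      · simpa [hc1] using (hU _).1 (hab t ht)
    · obtain ⟨t, ht, h0, h1⟩ := F4.exists_notMem_pair c e 0 1 he
      have := (hU _).1 (hab t ht)
      simp [h0, h1] at this

end Affine

lemma bracket4_succ (e : ℕ) : bracket4 (e + 1) = bracket4 e + 4 ^ (e + 1) :=
  Finset.sum_range_succ _ _

lemma three_mul_bracket4 (e : ℕ) : 3 * bracket4 e + 1 = 4 ^ (e + 1) := by
  induction e with
  | zero => rfl
  | succ e ih => rw [bracket4_succ, pow_succ]; omega

lemma hasFreeTriple_of_add_two_le_bracket4 (d : ℕ) (k : ℕ) (hk : k + 2 ≤ bracket4 (d + 1)) :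
    HasFreeTriple (Fin (d + 2) → F4) k := by
  induction d generalizing k with
  | zero =>
    have : bracket4 1 = 5 := rfl
    rw [zero_add] at hk
    exact (hasFreeTriple_plane (by omega)).of_linearEquiv (LinearEquiv.finTwoArrow F4 F4).symm
  | succ d ih =>
    have e : ((Fin (d + 2) → F4) × F4) ≃ₗ[F4] (Fin (d + 1 + 2) → F4) :=
      LinearEquiv.ofFinrankEq _ _ (by simp)
    refine HasFreeTriple.of_linearEquiv e ?_
    have h1 := bracket4_succ (d + 1)
    have h3 := three_mul_bracket4 (d + 1)
    by_cases hlt : k / 4 + 2 ≤ bracket4 (d + 1)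
    · rw [← Nat.div_add_mod k 4]
      exact (ih _ hlt).cylinder (by omega)
    · have hcard : Nat.card (Fin (d + 2) → F4) = 4 ^ (d + 1 + 1) := by
        rw [Nat.card_fun, F4.card, Nat.card_fin]
      have hpos := Nat.one_le_pow d 4 (by norm_num)
      have hpow : 4 ^ (d + 1) = 4 ^ d * 4 := pow_succ 4 d
      have h5 := bracket4_succ d
      obtain ⟨m, rfl⟩ : ∃ m, k = Nat.card (Fin (d + 2) → F4) + m :=
        Nat.exists_eq_add_of_le (by omega)
      exact (ih _ (by omega)).two_levels

lemma exists_affineLegal {d : ℕ} (hd : 2 ≤ d) {s : ℕ} (hs : s ≤ bracket4 (d - 1) + 1) :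
    ∃ S : Finset (Fin d → F4), S.card = s ∧ AffineLegal (S : Set (Fin d → F4)) := by
  classical
  obtain ⟨d, rfl⟩ := Nat.exists_eq_add_of_le' hd
  have h5 : 5 ≤ bracket4 (d + 1) := by
    have := three_mul_bracket4 (d + 1)
    have := Nat.one_le_pow d 4 (by norm_num)
    rw [pow_succ, pow_succ] at *
    omega
  obtain ⟨S, P, hS, hP, hd, hT⟩ := hasFreeTriple_of_add_two_le_bracket4 d (s - 3)
    (by rw [show d + 2 - 1 = d + 1 by omega] at hs; omega)
  obtain ⟨Q, hQP, hQ⟩ := Finset.exists_subset_card_eq (by omega : s - (s - 3) ≤ P.card)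
  refine ⟨S ∪ Q, ?_, by simpa using hT Q (by simpa using hQP)⟩
  rw [Finset.card_union_of_disjoint (hd.mono_right hQP)]
  omega

section Projective

variable {d : ℕ}

lemma mem_pointsIn {W : Submodule F4 (Fin (d + 1) → F4)} {p : PGPoint d} :
    p ∈ pointsIn W ↔ p.submodule ≤ W := Iff.rfl

lemma mk_mem_pointsIn {W : Submodule F4 (Fin (d + 1) → F4)} {u : Fin (d + 1) → F4} (hu : u ≠ 0) :
    Projectivization.mk F4 u hu ∈ pointsIn W ↔ u ∈ W := by
  simp [pointsIn, Projectivization.submodule_mk]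

lemma ncard_pointsIn (W : Submodule F4 (Fin (d + 1) → F4)) :
    (pointsIn W).ncard = ∑ i ∈ Finset.range (Module.finrank F4 W), 4 ^ i := by
  have hinj := Submodule.subtype_injective W
  have : pointsIn W = Set.range (Projectivization.map W.subtype hinj) := by
    ext p
    induction p using Projectivization.ind with | h u hu
    rw [mk_mem_pointsIn]
    constructor
    · intro h
      exact ⟨Projectivization.mk F4 ⟨u, h⟩ (by simpa using hu), rfl⟩
    · rintro ⟨q, hq⟩
      induction q using Projectivization.ind with | h x hx
      rw [Projectivization.map_mk, Projectivization.mk_eq_mk_iff] at hq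
      obtain ⟨c, hc⟩ := hq
      have : u = (c⁻¹ • x : W) := by
        rw [Submodule.coe_smul_of_tower, eq_inv_smul_iff]; exact hc
      exact this ▸ Submodule.coe_mem _
  rw [this, ← Set.image_univ, Set.ncard_image_of_injective _ (Projectivization.map_injective _ hinj),
    Set.ncard_univ, Projectivization.card_of_finrank F4 W rfl, F4.card]

lemma finrank_submodule_sup {p q : PGPoint d} (hpq : p ≠ q) :
    Module.finrank F4 ↥(p.submodule ⊔ q.submodule) = 2 := by
  have h := Submodule.finrank_sup_add_finrank_inf_eq p.submodule q.submodule
  have hp := p.finrank_submodule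
  have hq := q.finrank_submodule
  have hle := Submodule.finrank_mono (inf_le_left : p.submodule ⊓ q.submodule ≤ p.submodule)
  suffices Module.finrank F4 ↥(p.submodule ⊓ q.submodule) ≠ 1 by omega
  intro h1
  exact hpq (Projectivization.submodule_injective
    ((Submodule.eq_of_le_of_finrank_eq inf_le_left (h1.trans hp.symm)).symm.trans
      (Submodule.eq_of_le_of_finrank_eq inf_le_right (h1.trans hq.symm))))

lemma eq_submodule_sup {p q : PGPoint d} (hpq : p ≠ q) {W : Submodule F4 (Fin (d + 1) → F4)}
    (hW : Module.finrank F4 W = 2) (hp : p ∈ pointsIn W) (hq : q ∈ pointsIn W) :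
    W = p.submodule ⊔ q.submodule :=
  (Submodule.eq_of_le_of_finrank_eq (sup_le hp hq)
    ((finrank_submodule_sup hpq).trans hW.symm)).symm

/-- The point of `PG_d(4)` with homogeneous coordinates `(1, a)`. -/
noncomputable def affinePoint (a : Fin d → F4) : PGPoint d :=
  Projectivization.mk F4 (Fin.cons 1 a) fun h ↦ one_ne_zero (congrFun h 0)

lemma affinePoint_injective : Function.Injective (affinePoint (d := d)) := by
  intro a b hab
  obtain ⟨c, hc⟩ := (Projectivization.mk_eq_mk_iff' _ _ _ _ _).1 hab
  have h0 : c = 1 := by simpa using congrFun hc 0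
  subst h0
  simpa using hc.symm

lemma mk_eq_affinePoint {u : Fin (d + 1) → F4} (hu : u ≠ 0) (h0 : u 0 ≠ 0) :
    Projectivization.mk F4 u hu = affinePoint ((u 0)⁻¹ • Fin.tail u) := by
  refine (Projectivization.mk_eq_mk_iff' _ _ _ _ _).2 ⟨u 0, ?_⟩
  ext i
  refine Fin.cases ?_ (fun i ↦ ?_) i <;> simp [h0, Fin.tail]

lemma mk_ne_affinePoint {u : Fin (d + 1) → F4} (hu : u ≠ 0) (h0 : u 0 = 0) (a : Fin d → F4) :
    Projectivization.mk F4 u hu ≠ affinePoint a := by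
  intro h
  obtain ⟨c, hc⟩ := (Projectivization.mk_eq_mk_iff' _ _ _ _ _).1 h.symm
  simpa [h0] using congrFun hc 0

lemma exists_mem_apply_zero_eq_zero {W : Submodule F4 (Fin (d + 1) → F4)}
    (hW : Module.finrank F4 W = 2) : ∃ b ∈ W, b ≠ 0 ∧ b 0 = 0 := by
  let f : W →ₗ[F4] F4 := LinearMap.proj 0 ∘ₗ W.subtype
  have hf : f.ker ≠ ⊥ := LinearMap.ker_ne_bot_of_finrank_lt (by simp [hW])
  obtain ⟨x, hx, hx0⟩ := Submodule.exists_mem_ne_zero_of_ne_bot hf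
  exact ⟨x, x.2, by simpa using hx0, hx⟩

lemma legalTrunc_affinePoint_image {S : Set (Fin d → F4)} (hS : AffineLegal S) :
    LegalTrunc (affinePoint '' S) := by
  rintro _ ⟨W, hW, rfl⟩ h
  obtain ⟨b, hbW, hb, hb0⟩ := exists_mem_apply_zero_eq_zero hW
  have hbD : Projectivization.mk F4 b hb ∈ pointsIn W \ affinePoint '' S :=
    ⟨(mk_mem_pointsIn hb).2 hbW, fun ⟨a, _, ha⟩ ↦ mk_ne_affinePoint hb hb0 a ha.symm⟩
  obtain ⟨p, hp, hpb⟩ := Set.exists_ne_of_one_lt_ncard (h ▸ one_lt_two)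
    (Projectivization.mk F4 b hb)
  have honly : ∀ r ∈ pointsIn W, r ≠ p → r ≠ Projectivization.mk F4 b hb →
      r ∈ affinePoint '' S := by
    intro r hr hrp hrb
    by_contra hrS
    refine h.not_gt ((Set.two_lt_ncard_iff).2 ⟨r, p, _, ⟨hr, hrS⟩, hp, hbD, hrp, hrb, hpb⟩)
  obtain ⟨hpW, hpS⟩ := hp
  induction p using Projectivization.ind with | h u hu
  rw [mk_mem_pointsIn] at hpW
  by_cases hu0 : u 0 = 0
  · have hub : ∀ c : F4, c • b ≠ u := fun c hc ↦
      hpb ((Projectivization.mk_eq_mk_iff' _ _ _ _ _).2 ⟨c, hc⟩)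
    have hbu : ∀ c : F4, c • u ≠ b := fun c hc ↦
      hpb ((Projectivization.mk_eq_mk_iff' _ _ _ _ _).2 ⟨c, hc⟩).symm
    have hne : u + b ≠ 0 := fun h ↦ hub (-1) <| by
      rw [neg_one_smul]
      exact (eq_neg_of_add_eq_zero_left h).symm
    obtain ⟨a, -, ha⟩ := honly (.mk F4 (u + b) hne) ((mk_mem_pointsIn _).2 (add_mem hpW hbW))
      (fun h ↦ by
        obtain ⟨c, hc⟩ := (Projectivization.mk_eq_mk_iff' _ _ _ _ _).1 h
        exact hbu (c - 1) (by rw [sub_smul, hc, one_smul, add_sub_cancel_left]))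
      (fun h ↦ by
        obtain ⟨c, hc⟩ := (Projectivization.mk_eq_mk_iff' _ _ _ _ _).1 h
        exact hub (c - 1) (by rw [sub_smul, hc, one_smul, add_sub_cancel_right]))
    exact mk_ne_affinePoint _ (by simp [hu0, hb0]) a ha.symm
  · rw [mk_eq_affinePoint hu hu0] at *
    refine hpS ⟨_, hS _ (Fin.tail b) fun t ht ↦ ?_, rfl⟩
    have hmem : affinePoint ((u 0)⁻¹ • Fin.tail u + t • Fin.tail b) ∈ pointsIn W := by
      refine (mk_mem_pointsIn _).2 ?_
      convert W.add_mem (W.smul_mem (u 0)⁻¹ hpW) (W.smul_mem t hbW) using 1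
      ext i
      refine Fin.cases ?_ (fun i ↦ ?_) i <;> simp [hu0, hb0, Fin.tail]
    have htail : Fin.tail b ≠ 0 := by
      intro h
      apply hb
      rw [← Fin.cons_self_tail b, h, hb0]
      exact Matrix.cons_zero_zero
    obtain ⟨a, ha, hab⟩ := honly _ hmem
      (fun h ↦ smul_ne_zero ht htail (by simpa using affinePoint_injective h))
      (mk_ne_affinePoint hb hb0 _).symm
    exact affinePoint_injective hab ▸ ha

lemma ncard_pointsIn_le {W : Submodule F4 (Fin (d + 1) → F4)} {n : ℕ}
    (h : Module.finrank F4 W ≤ n) : (pointsIn W).ncard ≤ ∑ i ∈ Finset.range n, 4 ^ i := by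
  rw [ncard_pointsIn]
  exact Finset.sum_le_sum_of_subset (Finset.range_mono h)

lemma ncard_univ_diff (D : Set (PGPoint d)) :
    (Set.univ \ D).ncard = bracket4 d - D.ncard := by
  rw [Set.ncard_sdiff (Set.subset_univ _), Set.ncard_univ,
    Projectivization.card_of_finrank F4 _ (Module.finrank_fin_fun F4), F4.card, bracket4]

/-- The truncated lines of a legal truncation form a pairwise balanced design with block sizes
`3`, `4`, `5`, in which any three points lie in a truncated plane. -/
lemma LegalTrunc.exists_isPBD {D : Set (PGPoint d)} (hD : LegalTrunc D) {X : Type*} [Fintype X]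
    (f : X ≃ ↥(Set.univ \ D)) :
    ∃ Blocks : Finset (Finset X), IsPBD Finset.univ ({3, 4, 5} : Set ℕ) Blocks ∧
      ∀ S : Finset X, S.card = 3 →
        ∃ Y : Finset X, IsFlat Finset.univ Blocks Y ∧ S ⊆ Y ∧ Y.card ≤ 21 := by
  classical
  let g : X → PGPoint d := fun x ↦ f x
  have hg : Function.Injective g := Subtype.val_injective.comp f.injective
  let trace (W : Submodule F4 (Fin (d + 1) → F4)) : Finset X := {x | g x ∈ pointsIn W}
  have mem_trace : ∀ W x, x ∈ trace W ↔ g x ∈ pointsIn W := by simp [trace]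
  have card_trace : ∀ W, (trace W).card = (pointsIn W \ D).ncard := by
    intro W
    rw [← Set.ncard_coe_finset, ← Set.ncard_image_of_injective _ hg]
    congr 1
    ext p
    constructor
    · rintro ⟨x, hx, rfl⟩
      exact ⟨(mem_trace W x).1 hx, (f x).2.2⟩
    · rintro ⟨hp, hpD⟩
      have hfp : g (f.symm ⟨p, trivial, hpD⟩) = p := by simp [g]
      exact ⟨f.symm ⟨p, trivial, hpD⟩, (mem_trace W _).2 (hfp.symm ▸ hp), hfp⟩
  have card_trace_le : ∀ {W : Submodule F4 (Fin (d + 1) → F4)} {n}, Module.finrank F4 W ≤ n →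
      (trace W).card ≤ ∑ i ∈ Finset.range n, 4 ^ i := fun {W n} hW ↦ by
    rw [card_trace]
    exact (Set.ncard_le_ncard Set.sdiff_subset).trans (ncard_pointsIn_le hW)
  let Blocks : Finset (Finset X) := {B | 3 ≤ B.card ∧
    ∃ W : Submodule F4 (Fin (d + 1) → F4), Module.finrank F4 W = 2 ∧ B = trace W}
  have mem_Blocks : ∀ B, B ∈ Blocks ↔ 3 ≤ B.card ∧
      ∃ W : Submodule F4 (Fin (d + 1) → F4), Module.finrank F4 W = 2 ∧ B = trace W := by
    simp [Blocks]
  have join_mem : ∀ x y, x ≠ y → trace ((g x).submodule ⊔ (g y).submodule) ∈ Blocks ∧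
      x ∈ trace ((g x).submodule ⊔ (g y).submodule) ∧
      y ∈ trace ((g x).submodule ⊔ (g y).submodule) := by
    intro x y hxy
    have hW := finrank_submodule_sup (hg.ne hxy)
    have hx := (mem_trace ((g x).submodule ⊔ (g y).submodule) x).2 (mem_pointsIn.2 le_sup_left)
    have hy := (mem_trace ((g x).submodule ⊔ (g y).submodule) y).2 (mem_pointsIn.2 le_sup_right)
    refine ⟨(mem_Blocks _).2 ⟨?_, _, hW, rfl⟩, hx, hy⟩
    have h1 := Finset.one_lt_card.2 ⟨x, hx, y, hy, hxy⟩
    have h2 := hD _ ⟨_, hW, rfl⟩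
    rw [← card_trace] at h2
    omega
  refine ⟨Blocks, ⟨fun B hB ↦ ?_, fun x _ y _ hxy ↦ ?_⟩, fun S hS ↦ ?_⟩
  · obtain ⟨h3, W, hW, rfl⟩ := (mem_Blocks _).1 hB
    have h5 := card_trace_le hW.le
    simp only [Finset.sum_range_succ, Finset.sum_range_zero] at h5
    refine ⟨Finset.subset_univ _, ?_⟩
    simp only [Set.mem_insert_iff, Set.mem_singleton_iff]
    omega
  · refine ⟨_, join_mem x y hxy, ?_⟩
    rintro B ⟨hB, hxB, hyB⟩
    obtain ⟨-, W, hW, rfl⟩ := (mem_Blocks _).1 hB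
    rw [eq_submodule_sup (hg.ne hxy) hW ((mem_trace _ _).1 hxB) ((mem_trace _ _).1 hyB)]
  · obtain ⟨x, y, z, -, -, -, rfl⟩ := Finset.card_eq_three.1 hS
    refine ⟨trace ((g x).submodule ⊔ (g y).submodule ⊔ (g z).submodule),
      ⟨Finset.subset_univ _, fun a ha b hb hab ↦ ⟨_, (join_mem a b hab).1, (join_mem a b hab).2.1,
        (join_mem a b hab).2.2, fun c hc ↦ ?_⟩⟩, ?_, ?_⟩
    · rw [mem_trace, mem_pointsIn] at *
      exact hc.trans (sup_le ha hb)
    · simp only [Finset.insert_subset_iff, Finset.singleton_subset_iff, mem_trace, mem_pointsIn]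
      exact ⟨le_sup_left.trans le_sup_left, le_sup_right.trans le_sup_left, le_sup_right⟩
    · refine (card_trace_le (n := 3) ?_).trans (by simp [Finset.sum_range_succ])
      have h1 := Submodule.finrank_add_le_finrank_add_finrank (g x).submodule (g y).submodule
      have h2 := Submodule.finrank_add_le_finrank_add_finrank
        ((g x).submodule ⊔ (g y).submodule) (g z).submodule
      simp only [Projectivization.finrank_submodule] at h1 h2
      omega

end Projective

/-- For every `d ≥ 3` and every `v` with `3[d-1]₄ ≤ v ≤ [d]₄`, the projective space
`PG_d(4)` admits a legal truncation leaving exactly `v` points; consequently there is a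
`PBD(v,{3,4,5})` in which every set of three points lies in a flat of size at most `21`. -/
theorem statement10 (d : ℕ) (hd : 3 ≤ d) (v : ℕ)
    (h1 : 3 * bracket4 (d - 1) ≤ v) (h2 : v ≤ bracket4 d) :
    (∃ D : Set (PGPoint d), LegalTrunc D ∧ (Set.univ \ D).ncard = v) ∧
    ∃ Blocks : Finset (Finset (Fin v)), IsPBD Finset.univ ({3, 4, 5} : Set ℕ) Blocks ∧
      ∀ S : Finset (Fin v), S.card = 3 →
        ∃ Y : Finset (Fin v), IsFlat Finset.univ Blocks Y ∧ S ⊆ Y ∧ Y.card ≤ 21 := by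
  obtain ⟨e, rfl⟩ := Nat.exists_eq_add_of_le' (by omega : 1 ≤ d)
  have hb := bracket4_succ e
  have hb3 := three_mul_bracket4 e
  obtain ⟨S, hS, hleg⟩ := exists_affineLegal (by omega : 2 ≤ e + 1)
    (s := bracket4 (e + 1) - v) (by rw [Nat.add_sub_cancel] at *; omega)
  have hD := legalTrunc_affinePoint_image hleg
  have hcard : (Set.univ \ affinePoint '' (S : Set (Fin (e + 1) → F4))).ncard = v := by
    rw [ncard_univ_diff, Set.ncard_image_of_injective _ affinePoint_injective,
      Set.ncard_coe_finset, hS]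
    omega
  exact ⟨⟨_, hD, hcard⟩, hD.exists_isPBD (Finite.equivFinOfCardEq hcard).symm⟩
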